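/- arXiv:2303.17278 — 10 statements merged into one kernel-verified Lean document; each statement's English description precedes it below -/
import Mathlib

section
/- Let A be a d1-dimensional k1-stochastic matrix of order n (1 ≤ k1 ≤ d1) and B be a d2-dimensional k2-stochastic matrix of order n (1 ≤ k2 ≤ d2), and set r = max{d1 + k2, d2 + k1}. Then the matrix n^{k1 + k2 − r} · (A × B) is an r-stochastic (d1 + d2)-dimensional matrix of order n. -/
open scoped BigOperators

/-- A `d`-dimensional matrix of order `n`: an array of reals indexed by `{1,…,n}^d`. -/
abbrev MDMatrix (d n : ℕ) := (Fin d → Fin n) → ℝ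

namespace MDMatrix

noncomputable section

/-- The matrix is (entrywise) nonnegative. -/
def Nonneg {d n : ℕ} (A : MDMatrix d n) : Prop := ∀ α, 0 ≤ A α

/-- `A` is `k`-stochastic: it is nonnegative and the sum of its entries over every
`k`-dimensional plane equals `1`.  A `k`-dimensional plane is specified by the set `F`
of fixed positions (with `F.card = d - k`) together with the fixed values `f` at those
positions; the sum runs over all indices agreeing with `f` on `F`. -/
def IsStochastic {d n : ℕ} (k : ℕ) (A : MDMatrix d n) : Prop :=
  Nonneg A ∧
    ∀ F : Finset (Fin d), F.card = d - k → ∀ f : Fin d → Fin n,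
      ∑ α ∈ Finset.univ.filter (fun α : Fin d → Fin n => ∀ i ∈ F, α i = f i), A α = 1

/-- The outer product `A × B`. -/
def outer {d1 d2 n : ℕ} (A : MDMatrix d1 n) (B : MDMatrix d2 n) : MDMatrix (d1 + d2) n :=
  fun γ => A (fun i => γ (Fin.castAdd d2 i)) * B (fun j => γ (Fin.natAdd d1 j))

/-- The Kronecker product `A ⊗ B`: the entry at `γ` is `a_α * b_β` where
`γ i` encodes the pair `(α i, β i)` (i.e. `γ_i = (α_i - 1)·n2 + β_i` in 1-based terms). -/
def kron {d n1 n2 : ℕ} (A : MDMatrix d n1) (B : MDMatrix d n2) : MDMatrix d (n1 * n2) :=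
  fun γ => A (fun i => (finProdFinEquiv.symm (γ i)).1) * B (fun i => (finProdFinEquiv.symm (γ i)).2)

/-- The `S`-contraction `A_S`: at index `β` it is `∑_{i=1}^n a_γ` where `γ` has all
components in positions of `S` equal to `i` and agrees with `β` (read along the
increasing enumeration of `Sᶜ`) elsewhere. -/
def contract {d n : ℕ} (A : MDMatrix d n) (S : Finset (Fin d)) {e : ℕ}
    (h : Sᶜ.card = e) : MDMatrix e n :=
  fun β => ∑ i : Fin n, A fun j =>
    if hj : j ∈ S then i
    else β ((Sᶜ.orderIsoOfFin h).symm ⟨j, Finset.mem_compl.mpr hj⟩)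

/-- The `S`-projection `P_S(A)`: at index `β` it is the sum of `a_γ` over all indices `γ`
agreeing with `β` outside of `S` (components at positions of `S` range independently). -/
def project {d n : ℕ} (A : MDMatrix d n) (S : Finset (Fin d)) {e : ℕ}
    (h : Sᶜ.card = e) : MDMatrix e n :=
  fun β => ∑ g : S → Fin n, A fun j =>
    if hj : j ∈ S then g ⟨j, hj⟩
    else β ((Sᶜ.orderIsoOfFin h).symm ⟨j, Finset.mem_compl.mpr hj⟩)

/-- The dot product `AB` of a `(e1+1)`-dimensional and a `(e2+1)`-dimensional matrix:
`(AB)_{αβ} = ∑_i a_{α i} b_{i β}`. -/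
def dot {e1 e2 n : ℕ} (A : MDMatrix (e1 + 1) n) (B : MDMatrix (e2 + 1) n) :
    MDMatrix (e1 + e2) n :=
  fun γ => ∑ i : Fin n,
    A (Fin.snoc (fun j => γ (Fin.castAdd e2 j)) i) *
      B (Fin.cons i fun j => γ (Fin.natAdd e1 j))

/-- The circle product `A ∘ B`:
`(A∘B)_{i β_2 ⋯ β_{d1}} = ∑_{j_2,…,j_{d1}} a_{i j_2 ⋯ j_{d1}} b_{j_2 β_2} ⋯ b_{j_{d1} β_{d1}}`.
The index `γ : Fin (e1*e2+1)` consists of the head `γ 0 = i` followed by `e1` blocks of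
length `e2` (block `k`, position `m` sits at `(finProdFinEquiv (k, m)).succ`). -/
def circ {e1 e2 n : ℕ} (A : MDMatrix (e1 + 1) n) (B : MDMatrix (e2 + 1) n) :
    MDMatrix (e1 * e2 + 1) n :=
  fun γ => ∑ j : Fin e1 → Fin n,
    A (Fin.cons (γ 0) j) *
      ∏ k : Fin e1, B (Fin.cons (j k) fun m => γ (finProdFinEquiv (k, m)).succ)

/-- `J_n^d`: the `d`-dimensional matrix of order `n` all of whose entries equal `1/n`. -/
def J (d n : ℕ) : MDMatrix d n := fun _ => 1 / (n : ℝ)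

/-- The permanent: `per A = ∑_{σ_2,…,σ_d ∈ S_n} ∏_{i=1}^n a_{i, σ_2(i), …, σ_d(i)}`. -/
def per {d n : ℕ} (A : MDMatrix d n) : ℝ :=
  ∑ σ : Fin (d - 1) → Equiv.Perm (Fin n), ∏ i : Fin n,
    A fun k => if h : (k : ℕ) = 0 then i
      else σ ⟨(k : ℕ) - 1, by have := k.isLt; omega⟩ i

/-- A multidimensional permutation: a `(0,1)`-matrix in which every line (the `1`-dimensional
plane obtained by varying coordinate `j` of a base index `f`) contains exactly one `1`. -/
def IsPermutationMatrix {d n : ℕ} (M : MDMatrix d n) : Prop :=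
  (∀ α, M α = 0 ∨ M α = 1) ∧
    ∀ (j : Fin d) (f : Fin d → Fin n), ∃! x : Fin n, M (Function.update f j x) = 1

end

end MDMatrix

namespace MDMatrix

/-- In a `k`-stochastic matrix, planes of dimension at least `k` have entry sum a power of the
order. -/
theorem IsStochastic.sum_eq_pow {d n k : ℕ} {A : MDMatrix d n} (hA : IsStochastic k A)
    (m : ℕ) (F : Finset (Fin d)) (hF : F.card + m = d - k) (f : Fin d → Fin n) :
    ∑ α ∈ Finset.univ.filter (fun α : Fin d → Fin n => ∀ i ∈ F, α i = f i), A α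
      = (n : ℝ) ^ m := by
  induction m generalizing F f with
  | zero => simpa using hA.2 F (by omega) f
  | succ m ih =>
    obtain ⟨i, hi⟩ : ∃ i, i ∉ F := by
      by_contra! h
      have hu : F = Finset.univ := Finset.eq_univ_iff_forall.mpr h
      rw [hu, Finset.card_univ, Fintype.card_fin] at hF
      omega
    rw [← Finset.sum_fiberwise _ (fun α : Fin d → Fin n => α i) A]
    have key : ∀ v : Fin n,
        ∑ α ∈ (Finset.univ.filter (fun α : Fin d → Fin n => ∀ j ∈ F, α j = f j)).filter
          (fun α => α i = v), A α = (n : ℝ) ^ m := by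
      intro v
      rw [← ih (insert i F) (by rw [Finset.card_insert_of_notMem hi]; omega)
        (Function.update f i v), Finset.filter_filter]
      refine Finset.sum_congr (Finset.filter_congr fun α _ => ?_) fun _ _ => rfl
      have hne : ∀ j ∈ F, Function.update f i v j = f j := fun j hj =>
        Function.update_of_ne (ne_of_mem_of_not_mem hj hi) _ _
      simp only [Finset.forall_mem_insert, Function.update_self]
      rw [and_comm]
      exact and_congr_right fun _ => forall₂_congr fun j hj => by rw [hne j hj]
    rw [Finset.sum_congr rfl fun v _ => key v]
    simp [pow_succ']

/-- The sum of an outer product over a plane is the product of the sums over the two planes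
that it restricts to. -/
theorem sum_outer {d1 d2 n : ℕ} (A : MDMatrix d1 n) (B : MDMatrix d2 n)
    (F : Finset (Fin (d1 + d2))) (f : Fin (d1 + d2) → Fin n) :
    ∑ γ ∈ Finset.univ.filter (fun γ : Fin (d1 + d2) → Fin n => ∀ i ∈ F, γ i = f i), outer A B γ
      = (∑ α ∈ Finset.univ.filter (fun α : Fin d1 → Fin n =>
            ∀ i ∈ Finset.univ.filter (fun i => Fin.castAdd d2 i ∈ F),
              α i = f (Fin.castAdd d2 i)), A α) *
        ∑ β ∈ Finset.univ.filter (fun β : Fin d2 → Fin n =>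
            ∀ j ∈ Finset.univ.filter (fun j => Fin.natAdd d1 j ∈ F),
              β j = f (Fin.natAdd d1 j)), B β := by
  rw [Finset.sum_mul_sum, ← Finset.sum_product']
  symm
  refine Finset.sum_equiv (Fin.appendEquiv d1 d2) (fun p => ?_) fun p _ => ?_
  · simp [Fin.forall_fin_add, Fin.appendEquiv]
  · simp [outer, Fin.appendEquiv]

theorem card_filter_castAdd_add_card_filter_natAdd {d1 d2 : ℕ} (F : Finset (Fin (d1 + d2))) :
    (Finset.univ.filter (fun i => Fin.castAdd d2 i ∈ F)).card +
      (Finset.univ.filter (fun j => Fin.natAdd d1 j ∈ F)).card = F.card := by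
  simp only [Finset.card_filter]
  rw [← Fin.sum_univ_add (fun i => if i ∈ F then 1 else 0), ← Finset.card_filter]
  simp

end MDMatrix

open MDMatrix in
/-- the outer product of a `k1`-stochastic and a `k2`-stochastic matrix,
rescaled by `n^(k1+k2-r)` with `r = max (d1+k2) (d2+k1)`, is `r`-stochastic. -/
theorem outer_product_stochastic {d1 d2 k1 k2 n : ℕ}
    (A : MDMatrix d1 n) (B : MDMatrix d2 n)
    (hk1 : 1 ≤ k1) (hk1d : k1 ≤ d1) (hk2 : 1 ≤ k2) (hk2d : k2 ≤ d2)
    (hA : IsStochastic k1 A) (hB : IsStochastic k2 B) :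
    IsStochastic (max (d1 + k2) (d2 + k1))
      (fun γ => (n : ℝ) ^ ((k1 : ℤ) + (k2 : ℤ) - (max (d1 + k2) (d2 + k1) : ℤ)) *
        outer A B γ) := by
  refine ⟨fun γ => mul_nonneg (by positivity) (mul_nonneg (hA.1 _) (hB.1 _)), fun F hF f => ?_⟩
  have hn : (n : ℝ) ≠ 0 := by
    have := (f ⟨0, by omega⟩).pos
    positivity
  have hcard := card_filter_castAdd_add_card_filter_natAdd F
  rw [← Finset.mul_sum, sum_outer]
  set F1 := Finset.univ.filter (fun i => Fin.castAdd d2 i ∈ F)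
  set F2 := Finset.univ.filter (fun j => Fin.natAdd d1 j ∈ F)
  rw [hA.sum_eq_pow (d1 - k1 - F1.card) F1 (by omega) (fun i => f (Fin.castAdd d2 i)),
    hB.sum_eq_pow (d2 - k2 - F2.card) F2 (by omega) (fun j => f (Fin.natAdd d1 j)),
    ← pow_add, ← zpow_natCast, ← zpow_add₀ hn]
  convert zpow_zero (n : ℝ) using 2
  omega
end

section
/- Let A be a d-dimensional k1-stochastic matrix of order n1 (1 ≤ k1 ≤ d) and B be a d-dimensional k2-stochastic matrix of order n2 (1 ≤ k2 ≤ d), and set r = max{k1, k2}. Then the matrix n1^{k1−r} · n2^{k2−r} · (A ⊗ B) is an r-stochastic d-dimensional matrix of order n1·n2. In particular, the Kronecker product of two polystochastic matrices is polystochastic. -/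
open scoped BigOperators

namespace MDMatrix

/-- Over a plane of dimension `k + m`, the entries of a `k`-stochastic matrix of order `n` sum
to `n ^ m`. -/
theorem IsStochastic.sum_plane {d n k : ℕ} {A : MDMatrix d n} (hA : IsStochastic k A) (m : ℕ)
    (F : Finset (Fin d)) (hF : F.card + k + m = d) (f : Fin d → Fin n) :
    ∑ α ∈ Finset.univ.filter (fun α : Fin d → Fin n => ∀ i ∈ F, α i = f i), A α =
      (n : ℝ) ^ m := by
  induction m generalizing F f with
  | zero => simpa using hA.2 F (by omega) f
  | succ m ih =>
    obtain ⟨i, hi⟩ : ∃ i, i ∉ F := by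
      by_contra! h
      have hcard := Finset.card_eq_iff_eq_univ F |>.mpr (Finset.eq_univ_of_forall h)
      rw [Fintype.card_fin] at hcard
      omega
    rw [← Finset.sum_fiberwise _ (fun α => α i)]
    have hfiber (x : Fin n) :
        ∑ α ∈ (Finset.univ.filter (fun α : Fin d → Fin n => ∀ j ∈ F, α j = f j)).filter
          (fun α => α i = x), A α = (n : ℝ) ^ m := by
      rw [← ih (insert i F) (by rw [Finset.card_insert_of_notMem hi]; omega)
        (Function.update f i x), Finset.filter_filter]
      congr 1
      ext α
      have hne : ∀ j ∈ F, j ≠ i := fun j hj h => hi (h ▸ hj)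
      simp only [Finset.mem_filter, Finset.mem_univ, true_and, Finset.forall_mem_insert,
        Function.update_self]
      rw [and_comm]
      refine and_congr_right fun _ => forall₂_congr fun j hj => ?_
      rw [Function.update_of_ne (hne j hj)]
    simp [hfiber, pow_succ']

/-- The sum of `A ⊗ B` over a plane is the product of the sums of `A` and `B` over the planes
given by the two components of the fixed values. -/
theorem sum_kron_plane {d n1 n2 : ℕ} (A : MDMatrix d n1) (B : MDMatrix d n2)
    (F : Finset (Fin d)) (f : Fin d → Fin (n1 * n2)) :
    ∑ γ ∈ Finset.univ.filter (fun γ : Fin d → Fin (n1 * n2) => ∀ i ∈ F, γ i = f i),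
        kron A B γ =
      (∑ α ∈ Finset.univ.filter (fun α : Fin d → Fin n1 =>
          ∀ i ∈ F, α i = (finProdFinEquiv.symm (f i)).1), A α) *
        ∑ β ∈ Finset.univ.filter (fun β : Fin d → Fin n2 =>
          ∀ i ∈ F, β i = (finProdFinEquiv.symm (f i)).2), B β := by
  rw [Finset.sum_mul_sum, ← Finset.sum_product']
  refine Finset.sum_equiv
    ((Equiv.arrowCongr (Equiv.refl (Fin d)) finProdFinEquiv.symm).trans
      (Equiv.arrowProdEquivProdArrow (Fin d) (fun _ => Fin n1) (fun _ => Fin n2))) ?_ ?_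
  · intro γ
    simp only [Finset.mem_filter, Finset.mem_univ, true_and, Finset.mem_product,
      ← forall₂_and]
    refine forall₂_congr fun i _ => ?_
    rw [← finProdFinEquiv.symm.injective.eq_iff, Prod.ext_iff]
    rfl
  · intro γ _
    rfl

theorem IsStochastic.kron_max {d k1 k2 n1 n2 : ℕ} {A : MDMatrix d n1} {B : MDMatrix d n2}
    (hk1 : 1 ≤ k1) (hk1d : k1 ≤ d) (hk2d : k2 ≤ d)
    (hA : IsStochastic k1 A) (hB : IsStochastic k2 B) :
    IsStochastic (max k1 k2)
      (fun γ => (n1 : ℝ) ^ ((k1 : ℤ) - (max k1 k2 : ℤ)) *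
        (n2 : ℝ) ^ ((k2 : ℤ) - (max k1 k2 : ℤ)) * kron A B γ) := by
  refine ⟨fun γ => mul_nonneg (by positivity) (mul_nonneg (hA.1 _) (hB.1 _)), fun F hF f => ?_⟩
  obtain ⟨a, ha⟩ := Nat.exists_eq_add_of_le (le_max_left k1 k2)
  obtain ⟨b, hb⟩ := Nat.exists_eq_add_of_le (le_max_right k1 k2)
  have hd : max k1 k2 ≤ d := max_le hk1d hk2d
  have hpos : 0 < n1 * n2 := Fin.pos (f ⟨0, by omega⟩)
  have hn1 : (n1 : ℝ) ≠ 0 := Nat.cast_ne_zero.mpr (Nat.pos_of_mul_pos_right hpos).ne'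
  have hn2 : (n2 : ℝ) ≠ 0 := Nat.cast_ne_zero.mpr (Nat.pos_of_mul_pos_left hpos).ne'
  have hexp1 : (k1 : ℤ) - max (k1 : ℤ) k2 = -(a : ℤ) := by omega
  have hexp2 : (k2 : ℤ) - max (k1 : ℤ) k2 = -(b : ℤ) := by omega
  rw [← Finset.mul_sum, sum_kron_plane, hA.sum_plane a F (by omega),
    hB.sum_plane b F (by omega), hexp1, hexp2, zpow_neg, zpow_neg, zpow_natCast, zpow_natCast]
  field_simp

end MDMatrix

open MDMatrix in
/-- the Kronecker product of a `k1`-stochastic and a `k2`-stochastic matrix,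
suitably rescaled, is `r`-stochastic with `r = max k1 k2`; in particular the Kronecker
product of polystochastic matrices is polystochastic. -/
theorem kron_product_stochastic {d k1 k2 n1 n2 : ℕ}
    (A : MDMatrix d n1) (B : MDMatrix d n2)
    (hk1 : 1 ≤ k1) (hk1d : k1 ≤ d) (hk2 : 1 ≤ k2) (hk2d : k2 ≤ d)
    (hA : IsStochastic k1 A) (hB : IsStochastic k2 B) :
    IsStochastic (max k1 k2)
      (fun γ => (n1 : ℝ) ^ ((k1 : ℤ) - (max k1 k2 : ℤ)) *
        (n2 : ℝ) ^ ((k2 : ℤ) - (max k1 k2 : ℤ)) * kron A B γ) ∧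
    (∀ (A' : MDMatrix d n1) (B' : MDMatrix d n2),
      IsStochastic 1 A' → IsStochastic 1 B' → IsStochastic 1 (kron A' B')) := by
  refine ⟨hA.kron_max hk1 hk1d hk2d hB, fun A' B' hA' hB' => ?_⟩
  simpa using hA'.kron_max le_rfl (hk1.trans hk1d) (hk1.trans hk1d) hB'
end

section
/- Let A be a d1-dimensional polystochastic matrix of order n (d1 ≥ 2) and B be a d2-dimensional polystochastic matrix of order n (d2 ≥ 2). Then the circle product A ∘ B is a ((d1−1)(d2−1)+1)-dimensional polystochastic matrix of order n. -/
open scoped BigOperators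

namespace MDMatrix

/-- The sum over a `1`-dimensional plane, written as a sum over its varying coordinate. -/
theorem sum_filter_compl_singleton {d n : ℕ} (A : MDMatrix d n) (p : Fin d) (f : Fin d → Fin n) :
    ∑ α ∈ Finset.univ.filter (fun α : Fin d → Fin n => ∀ i ∈ ({p}ᶜ : Finset (Fin d)), α i = f i),
      A α = ∑ x, A (Function.update f p x) := by
  have update_eq : ∀ α : Fin d → Fin n, (∀ i ∈ ({p}ᶜ : Finset (Fin d)), α i = f i) →
      Function.update f p (α p) = α := by
    intro α h
    ext i
    by_cases hi : i = p
    · subst hi; simp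
    · simp [hi, h i (by simpa using hi)]
  refine Finset.sum_nbij' (fun α => α p) (fun x => Function.update f p x) ?_ ?_ ?_ ?_ ?_
  · simp
  · intro x _
    simp only [Finset.mem_filter, Finset.mem_univ, true_and]
    intro i hi
    exact Function.update_of_ne (by simpa using hi) _ _
  · intro α h
    exact update_eq α (Finset.mem_filter.1 h).2
  · simp
  · intro α h
    rw [update_eq α (Finset.mem_filter.1 h).2]

/-- Polystochasticity means that all line sums are `1`. -/
theorem isStochastic_one_iff {e n : ℕ} (A : MDMatrix (e + 1) n) :
    IsStochastic 1 A ↔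
      Nonneg A ∧ ∀ (p : Fin (e + 1)) (f : Fin (e + 1) → Fin n),
        ∑ x, A (Function.update f p x) = 1 := by
  refine and_congr_right fun _ => ⟨fun h p f => ?_, fun h F hF f => ?_⟩
  · rw [← sum_filter_compl_singleton]
    exact h _ (by simp [Finset.card_compl]) f
  · obtain ⟨p, hp⟩ : ∃ p, Fᶜ = {p} := by
      rw [← Finset.card_eq_one, Finset.card_compl, hF]
      simp
    obtain rfl : F = {p}ᶜ := by rw [← hp, compl_compl]
    rw [sum_filter_compl_singleton, h]

theorem Nonneg.circ {e1 e2 n : ℕ} {A : MDMatrix (e1 + 1) n} {B : MDMatrix (e2 + 1) n}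
    (hA : Nonneg A) (hB : Nonneg B) : Nonneg (circ A B) := fun _ =>
  Finset.sum_nonneg fun _ _ => mul_nonneg (hA _) (Finset.prod_nonneg fun _ _ => hB _)

/-- Summing a product of weights of total mass `1` over all choice functions gives `1`. -/
theorem sum_prod_eq_one {e n : ℕ} (w : Fin e → Fin n → ℝ) (hw : ∀ k, ∑ x, w k x = 1) :
    ∑ j : Fin e → Fin n, ∏ k, w k (j k) = 1 := by
  rw [← Fintype.prod_sum]
  simp [hw]

theorem sum_cons_eq_one {e n : ℕ} {A : MDMatrix (e + 1) n}
    (hA : ∀ (p : Fin (e + 1)) (f : Fin (e + 1) → Fin n), ∑ x, A (Function.update f p x) = 1)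
    (i : Fin n) (j : Fin e → Fin n) : ∑ x, A (Fin.cons x j) = 1 := by
  simpa only [Fin.update_cons_zero] using hA 0 (Fin.cons i j)

theorem sum_circ_update_zero {e1 e2 n : ℕ} {A : MDMatrix (e1 + 1) n} {B : MDMatrix (e2 + 1) n}
    (hA : ∀ (p : Fin (e1 + 1)) (f : Fin (e1 + 1) → Fin n), ∑ x, A (Function.update f p x) = 1)
    (hB : ∀ (p : Fin (e2 + 1)) (f : Fin (e2 + 1) → Fin n), ∑ x, B (Function.update f p x) = 1)
    (γ : Fin (e1 * e2 + 1) → Fin n) : ∑ x, circ A B (Function.update γ 0 x) = 1 := by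
  simp only [circ, Function.update_self, ne_eq, Fin.succ_ne_zero, not_false_eq_true,
    Function.update_of_ne]
  rw [Finset.sum_comm]
  simp only [← Finset.sum_mul, sum_cons_eq_one hA (γ 0), one_mul]
  exact sum_prod_eq_one (fun k x => B (Fin.cons x fun m => γ (finProdFinEquiv (k, m)).succ))
    fun k => sum_cons_eq_one hB (γ 0) _

theorem sum_circ_update_succ {e1 e2 n : ℕ} {A : MDMatrix (e1 + 1) n} {B : MDMatrix (e2 + 1) n}
    (hA : ∀ (p : Fin (e1 + 1)) (f : Fin (e1 + 1) → Fin n), ∑ x, A (Function.update f p x) = 1)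
    (hB : ∀ (p : Fin (e2 + 1)) (f : Fin (e2 + 1) → Fin n), ∑ x, B (Function.update f p x) = 1)
    (γ : Fin (e1 * e2 + 1) → Fin n) (k : Fin e1) (m : Fin e2) :
    ∑ x, circ A B (Function.update γ (finProdFinEquiv (k, m)).succ x) = 1 := by
  obtain _ | e := e1
  · exact k.elim0
  have block_self : ∀ x, (fun l => Function.update γ (finProdFinEquiv (k, m)).succ x
      (finProdFinEquiv (k, l)).succ) =
      Function.update (fun l => γ (finProdFinEquiv (k, l)).succ) m x := by
    intro x
    ext l
    by_cases hl : l = m <;> simp [hl]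
  have block_ne : ∀ x i, (fun l => Function.update γ (finProdFinEquiv (k, m)).succ x
      (finProdFinEquiv (k.succAbove i, l)).succ) =
      fun l => γ (finProdFinEquiv (k.succAbove i, l)).succ := by
    intro x i
    ext l
    simp [Fin.succAbove_ne]
  have sum_line_A : ∀ (j : Fin e → Fin n),
      ∑ y, A (Fin.cons (γ 0) (k.insertNth y j : Fin (e + 1) → Fin n)) = 1 := by
    intro j
    rw [← hA k.succ (Fin.cons (γ 0) (k.insertNth (γ 0) j : Fin (e + 1) → Fin n))]
    simp only [← Fin.cons_update, Fin.update_insertNth]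
  have sum_line_B : ∀ y, ∑ x, B (Fin.cons y
      (Function.update (fun l => γ (finProdFinEquiv (k, l)).succ) m x)) = 1 := by
    intro y
    simpa only [Fin.cons_update] using hB m.succ _
  calc ∑ x, circ A B (Function.update γ (finProdFinEquiv (k, m)).succ x)
      = ∑ x, ∑ y, ∑ j : Fin e → Fin n,
          A (Fin.cons (γ 0) (k.insertNth y j : Fin (e + 1) → Fin n)) *
          (B (Fin.cons y (Function.update (fun l => γ (finProdFinEquiv (k, l)).succ) m x)) *
          ∏ i, B (Fin.cons (j i) fun l => γ (finProdFinEquiv (k.succAbove i, l)).succ)) := by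
        refine Finset.sum_congr rfl fun x _ => ?_
        rw [circ, ← (Fin.insertNthEquiv (fun _ => Fin n) k).sum_comp, Fintype.sum_prod_type]
        refine Finset.sum_congr rfl fun y _ => Finset.sum_congr rfl fun j _ => ?_
        rw [Fin.prod_univ_succAbove _ k, Function.update_of_ne (Fin.succ_ne_zero _).symm]
        simp only [Fin.insertNthEquiv_apply, Fin.insertNth_apply_same,
          Fin.insertNth_apply_succAbove, block_self, block_ne]
        rfl
    _ = ∑ y, ∑ j : Fin e → Fin n,
          A (Fin.cons (γ 0) (k.insertNth y j : Fin (e + 1) → Fin n)) *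
          ∏ i, B (Fin.cons (j i) fun l => γ (finProdFinEquiv (k.succAbove i, l)).succ) := by
        rw [Finset.sum_comm]
        refine Finset.sum_congr rfl fun y _ => ?_
        rw [Finset.sum_comm]
        simp only [← Finset.mul_sum, ← Finset.sum_mul, sum_line_B, one_mul]
    _ = 1 := by
        rw [Finset.sum_comm]
        simp only [← Finset.sum_mul, sum_line_A, one_mul]
        exact sum_prod_eq_one
          (fun i x => B (Fin.cons x fun l => γ (finProdFinEquiv (k.succAbove i, l)).succ))
          fun i => sum_cons_eq_one hB (γ 0) _

end MDMatrix

open MDMatrix in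
/-- the circle product of polystochastic matrices (here `d1 = e1 + 1 ≥ 2`,
`d2 = e2 + 1 ≥ 2`) is polystochastic. -/
theorem circle_product_polystochastic {e1 e2 n : ℕ} (he1 : 1 ≤ e1) (he2 : 1 ≤ e2)
    (A : MDMatrix (e1 + 1) n) (B : MDMatrix (e2 + 1) n)
    (hA : IsStochastic 1 A) (hB : IsStochastic 1 B) :
    IsStochastic 1 (circ A B) := by
  rw [isStochastic_one_iff] at hA hB ⊢
  refine ⟨hA.1.circ hB.1, fun p γ => ?_⟩
  induction p using Fin.cases with
  | zero => exact sum_circ_update_zero hA.2 hB.2 γ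
  | succ q =>
    obtain ⟨⟨k, m⟩, rfl⟩ := finProdFinEquiv.surjective q
    exact sum_circ_update_succ hA.2 hB.2 γ k m
end

section
/- Let M be a d1-dimensional multidimensional permutation of order n and N be a d2-dimensional multidimensional permutation of order n, with d1, d2 ≥ 2. Then the dot product M·N is a (d1 + d2 − 2)-dimensional multidimensional permutation of order n. (This is the matrix form of the statement that the multidimensional permutation corresponding to the composition f·g of two multiary quasigroups f and g is the dot product M^f · M^g of their permutation matrices.) -/
open scoped BigOperators

namespace MDMatrix

/-- If the `(0,1)`-vector `p` has its only `1` at `k`, then its dot product with `q` is `q k`. -/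
theorem sum_mul_eq_of_unique_one {ι : Type*} [Fintype ι] {p q : ι → ℝ}
    (hp : ∀ i, p i = 0 ∨ p i = 1) {k : ι} (hk : p k = 1) (huniq : ∀ i, p i = 1 → i = k) :
    ∑ i, p i * q i = q k := by
  rw [Finset.sum_eq_single k]
  · rw [hk, one_mul]
  · intro i _ hik
    rcases hp i with h | h
    · rw [h, zero_mul]
    · exact absurd (huniq i h) hik
  · intro h
    exact absurd (Finset.mem_univ k) h

theorem IsPermutationMatrix.existsUnique_snoc {e n : ℕ} {M : MDMatrix (e + 1) n}
    (hM : IsPermutationMatrix M) (hn : 0 < n) (α : Fin e → Fin n) :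
    ∃! i : Fin n, M (Fin.snoc α i) = 1 := by
  have h := hM.2 (Fin.last e) (Fin.snoc (α := fun _ => Fin n) α ⟨0, hn⟩)
  simpa only [Fin.update_snoc_last] using h

theorem IsPermutationMatrix.existsUnique_cons {e n : ℕ} {N : MDMatrix (e + 1) n}
    (hN : IsPermutationMatrix N) (hn : 0 < n) (β : Fin e → Fin n) :
    ∃! i : Fin n, N (Fin.cons i β) = 1 := by
  have h := hN.2 0 (Fin.cons (α := fun _ => Fin n) ⟨0, hn⟩ β)
  simpa only [Fin.update_cons_zero] using h

theorem dot_eq_of_left {e1 e2 n : ℕ} {M : MDMatrix (e1 + 1) n} (N : MDMatrix (e2 + 1) n)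
    (hM : IsPermutationMatrix M) (hn : 0 < n) (γ : Fin (e1 + e2) → Fin n) {k : Fin n}
    (hk : M (Fin.snoc (fun j => γ (Fin.castAdd e2 j)) k) = 1) :
    dot M N γ = N (Fin.cons k fun j => γ (Fin.natAdd e1 j)) :=
  sum_mul_eq_of_unique_one (fun _ => hM.1 _) hk
    fun _ hi => (hM.existsUnique_snoc hn _).unique hi hk

theorem dot_eq_of_right {e1 e2 n : ℕ} (M : MDMatrix (e1 + 1) n) {N : MDMatrix (e2 + 1) n}
    (hN : IsPermutationMatrix N) (hn : 0 < n) (γ : Fin (e1 + e2) → Fin n) {k : Fin n}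
    (hk : N (Fin.cons k fun j => γ (Fin.natAdd e1 j)) = 1) :
    dot M N γ = M (Fin.snoc (fun j => γ (Fin.castAdd e2 j)) k) := by
  unfold dot
  simp_rw [mul_comm (M _)]
  exact sum_mul_eq_of_unique_one (fun _ => hN.1 _) hk
    fun _ hi => (hN.existsUnique_cons hn _).unique hi hk

end MDMatrix

open MDMatrix in
/-- the dot product of two multidimensional permutations (of dimensions
`d1 = e1 + 1 ≥ 2` and `d2 = e2 + 1 ≥ 2` and the same order `n`) is a multidimensional
permutation. -/
theorem dot_product_permutation {e1 e2 n : ℕ} (he1 : 1 ≤ e1) (he2 : 1 ≤ e2)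
    (M : MDMatrix (e1 + 1) n) (N : MDMatrix (e2 + 1) n)
    (hM : IsPermutationMatrix M) (hN : IsPermutationMatrix N) :
    IsPermutationMatrix (dot M N) := by
  have pos_of_index : ∀ γ : Fin (e1 + e2) → Fin n, 0 < n := fun γ => (γ ⟨0, by omega⟩).pos
  refine ⟨fun γ => ?_, fun j γ => ?_⟩
  · have hn := pos_of_index γ
    obtain ⟨k, hk, -⟩ := hM.existsUnique_snoc hn fun j => γ (Fin.castAdd e2 j)
    rw [dot_eq_of_left N hM hn γ hk]
    exact hN.1 _
  · have hn := pos_of_index γ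
    induction j using Fin.addCases with
    | left j =>
      obtain ⟨k, hk, -⟩ := hN.existsUnique_cons hn fun j => γ (Fin.natAdd e1 j)
      have hβ (x : Fin n) : (fun i => Function.update γ (Fin.castAdd e2 j) x (Fin.natAdd e1 i)) =
          fun i => γ (Fin.natAdd e1 i) := by
        funext i
        exact Function.update_of_ne (by simp [Fin.ext_iff]; omega) _ _
      have hα (x : Fin n) : (fun i => Function.update γ (Fin.castAdd e2 j) x (Fin.castAdd e2 i)) =
          Function.update (fun i => γ (Fin.castAdd e2 i)) j x :=
        Function.update_comp_eq_of_injective γ (Fin.castAdd_injective e1 e2) j x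
      have hdot (x : Fin n) : dot M N (Function.update γ (Fin.castAdd e2 j) x) =
          M (Function.update (Fin.snoc (α := fun _ => Fin n) (fun i => γ (Fin.castAdd e2 i)) k)
            j.castSucc x) := by
        rw [dot_eq_of_right M hN hn _ (by rw [hβ]; exact hk), hα, Fin.snoc_update]
      simpa only [hdot] using hM.2 j.castSucc _
    | right j =>
      obtain ⟨k, hk, -⟩ := hM.existsUnique_snoc hn fun j => γ (Fin.castAdd e2 j)
      have hα (x : Fin n) : (fun i => Function.update γ (Fin.natAdd e1 j) x (Fin.castAdd e2 i)) =
          fun i => γ (Fin.castAdd e2 i) := by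
        funext i
        exact Function.update_of_ne (by simp [Fin.ext_iff]; omega) _ _
      have hβ (x : Fin n) : (fun i => Function.update γ (Fin.natAdd e1 j) x (Fin.natAdd e1 i)) =
          Function.update (fun i => γ (Fin.natAdd e1 i)) j x :=
        Function.update_comp_eq_of_injective γ (Fin.natAdd_injective e2 e1) j x
      have hdot (x : Fin n) : dot M N (Function.update γ (Fin.natAdd e1 j) x) =
          N (Function.update (Fin.cons (α := fun _ => Fin n) k fun i => γ (Fin.natAdd e1 i))
            j.succ x) := by
        rw [dot_eq_of_left N hM hn _ (by rw [hα]; exact hk), hβ, Fin.cons_update]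
      simpa only [hdot] using hN.2 j.succ _
end

section
/- Let A be a d1-dimensional matrix of order n and B be a d2-dimensional matrix of order n, with d1, d2 ≥ 1. Then per(A × B) = n! · (per A · per B). -/
open scoped BigOperators

namespace MDMatrix

theorem per_succ {e n : ℕ} (A : MDMatrix (e + 1) n) :
    per A = ∑ σ : Fin e → Equiv.Perm (Fin n), ∏ i : Fin n,
      A (Fin.cons i fun k => σ k i) := by
  refine Finset.sum_congr rfl fun σ _ => Finset.prod_congr rfl fun i _ => congrArg A ?_
  funext k
  cases k using Fin.cases with
  | zero => simp
  | succ k => simp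

/-- Letting a permutation act on the first coordinate as well multiplies the permanent by `n!`. -/
theorem factorial_mul_per {d n : ℕ} (hd : 1 ≤ d) (A : MDMatrix d n) :
    (n.factorial : ℝ) * per A =
      ∑ σ : Fin d → Equiv.Perm (Fin n), ∏ i : Fin n, A fun k => σ k i := by
  obtain ⟨e, rfl⟩ := Nat.exists_eq_add_of_le' hd
  rw [← (Fin.consEquiv fun _ : Fin (e + 1) => Equiv.Perm (Fin n)).sum_comp,
    Fintype.sum_prod_type]
  have hfiber (τ : Equiv.Perm (Fin n)) :
      ∑ σ : Fin e → Equiv.Perm (Fin n), ∏ i : Fin n,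
        A (fun k => (Fin.consEquiv (fun _ : Fin (e + 1) => Equiv.Perm (Fin n)) (τ, σ)) k i) =
      per A := by
    rw [per_succ, ← (Equiv.piCongrRight fun _ : Fin e => Equiv.mulRight τ).sum_comp]
    refine Finset.sum_congr rfl fun σ _ => ?_
    rw [← Equiv.prod_comp τ fun i => A (Fin.cons i fun k => σ k i)]
    refine Finset.prod_congr rfl fun i _ => congrArg A ?_
    funext k
    cases k using Fin.cases with
    | zero => simp [Fin.consEquiv]
    | succ k => simp [Fin.consEquiv]
  simp_rw [hfiber]
  simp [Fintype.card_perm]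

end MDMatrix

open MDMatrix in
/-- `per (A × B) = n! * (per A * per B)`. -/
theorem per_outer_product {d1 d2 n : ℕ} (hd1 : 1 ≤ d1) (hd2 : 1 ≤ d2)
    (A : MDMatrix d1 n) (B : MDMatrix d2 n) :
    per (outer A B) = (n.factorial : ℝ) * (per A * per B) := by
  have hn : (n.factorial : ℝ) ≠ 0 := Nat.cast_ne_zero.mpr n.factorial_ne_zero
  apply mul_left_cancel₀ hn
  have hAB : (n.factorial : ℝ) * per (outer A B) =
      (n.factorial * per A) * (n.factorial * per B) := by
    rw [factorial_mul_per (by omega) (outer A B), factorial_mul_per hd1 A,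
      factorial_mul_per hd2 B, ← (Fin.appendEquiv d1 d2).sum_comp, Fintype.sum_prod_type,
      Finset.sum_mul_sum]
    refine Finset.sum_congr rfl fun σ _ => Finset.sum_congr rfl fun τ _ => ?_
    simp [outer, Fin.appendEquiv, Finset.prod_mul_distrib]
  rw [hAB]
  ring
end

section
/- Let A be a d1-dimensional matrix of order n and B be a d2-dimensional matrix of order n, with d1, d2 ≥ 1, and let σ be any permutation of {1,…,n}. Define the (d1 + d2 − 1)-dimensional matrix C of order n by c_{iαβ} = a_{iα} · b_{σ(i)β} for i ∈ {1,…,n}, α ∈ {1,…,n}^{d1−1}, β ∈ {1,…,n}^{d2−1}. Then per C = per A · per B. In particular, for every pair of matrices A, B of the same order there exists a (d1 + d2 − 1)-dimensional matrix whose permanent equals per A · per B. -/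
open scoped BigOperators

namespace MDMatrix

theorem per_eq_sum_prod_cons {e n : ℕ} (A : MDMatrix (e + 1) n) :
    per A = ∑ τ : Fin e → Equiv.Perm (Fin n), ∏ i, A (Fin.cons i fun j => τ j i) := by
  refine Finset.sum_congr rfl fun τ _ => Finset.prod_congr rfl fun i _ => congrArg A ?_
  funext k
  induction k using Fin.cases <;> simp

/-- Permuting the hyperplanes of the first direction does not change the permanent. -/
theorem per_eq_sum_prod_cons_perm {e n : ℕ} (B : MDMatrix (e + 1) n) (σ : Equiv.Perm (Fin n)) :
    per B = ∑ τ : Fin e → Equiv.Perm (Fin n), ∏ i, B (Fin.cons (σ i) fun j => τ j i) := by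
  rw [per_eq_sum_prod_cons]
  refine Fintype.sum_equiv (Equiv.mulRight fun _ => σ) _ _ fun τ => ?_
  exact (Equiv.prod_comp σ fun i => B (Fin.cons i fun j => τ j i)).symm

end MDMatrix

open MDMatrix in
/-- for matrices `A` (dimension `d1 = e1 + 1`), `B` (dimension `d2 = e2 + 1`)
of order `n` and a permutation `σ` of `{1,…,n}`, the `(d1+d2-1)`-dimensional matrix `C`
with `c_{iαβ} = a_{iα} b_{σ(i)β}` satisfies `per C = per A * per B`; in particular some
`(d1+d2-1)`-dimensional matrix has permanent `per A * per B`. -/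
theorem per_composition_matrix {e1 e2 n : ℕ}
    (A : MDMatrix (e1 + 1) n) (B : MDMatrix (e2 + 1) n) (σ : Equiv.Perm (Fin n)) :
    per (fun γ : Fin (e1 + e2 + 1) → Fin n =>
        A (Fin.cons (γ 0) fun j => γ (Fin.succ (Fin.castAdd e2 j))) *
        B (Fin.cons (σ (γ 0)) fun j => γ (Fin.succ (Fin.natAdd e1 j)))) =
      per A * per B ∧
    ∃ C : MDMatrix (e1 + e2 + 1) n, per C = per A * per B := by
  refine (fun h => ⟨h, _, h⟩) ?_
  rw [per_eq_sum_prod_cons, per_eq_sum_prod_cons A, per_eq_sum_prod_cons_perm B σ,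
    Finset.sum_mul_sum, ← Fintype.sum_prod_type',
    ← Equiv.sum_comp (Fin.appendEquiv e1 e2)]
  refine Finset.sum_congr rfl fun τ _ => ?_
  simp [Fin.appendEquiv, Finset.prod_mul_distrib]
end

section
/- There exists a nonnegative 3-dimensional matrix A of order 3 such that per(A ⊗ A) < (per A)^6. (Hence the 2-dimensional lower bound per(A ⊗ B) ≥ (per A)^{n2}(per B)^{n1} of Brualdi fails for multidimensional matrices.) -/
open scoped BigOperators

namespace MDMatrix

/-- The cells `(i, σ₂ i, …, σ_d i)` over which `per` takes products. -/
def cell {d n : ℕ} (σ : Fin (d - 1) → Equiv.Perm (Fin n)) (i : Fin n) : Fin d → Fin n :=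
  fun k => if h : (k : ℕ) = 0 then i else σ ⟨(k : ℕ) - 1, by have := k.isLt; omega⟩ i

/-- The `(0,1)`-matrix with support `p`. -/
def ofPred {d n : ℕ} (p : (Fin d → Fin n) → Prop) [DecidablePred p] : MDMatrix d n :=
  fun α => if p α then 1 else 0

theorem per_ofPred {d n : ℕ} (p : (Fin d → Fin n) → Prop) [DecidablePred p] :
    per (ofPred p) = (Finset.univ.filter fun σ : Fin (d - 1) → Equiv.Perm (Fin n) =>
      ∀ i, p (cell σ i)).card := by
  rw [Finset.card_filter, Nat.cast_sum]
  refine Finset.sum_congr rfl fun σ _ => ?_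
  change ∏ i, ofPred p (cell σ i) = _
  simp [ofPred, Finset.prod_ite_zero]

theorem kron_ofPred {d n₁ n₂ : ℕ} (p : (Fin d → Fin n₁) → Prop) (q : (Fin d → Fin n₂) → Prop)
    [DecidablePred p] [DecidablePred q] :
    kron (ofPred p) (ofPred q) = ofPred fun γ : Fin d → Fin (n₁ * n₂) =>
      p (fun i => (finProdFinEquiv.symm (γ i)).1) ∧
        q (fun i => (finProdFinEquiv.symm (γ i)).2) := by
  funext γ
  simp only [kron, ofPred, ite_and, ite_mul, one_mul, zero_mul]

/-- All choices of one pair from each list of `opts` such that the first components are distinct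
and avoid `u`, and the second components are distinct and avoid `v`. -/
def transversals {α β : Type*} [DecidableEq α] [DecidableEq β] :
    List (List (α × β)) → List α → List β → List (List (α × β))
  | [], _, _ => [[]]
  | o :: opts, u, v => o.flatMap fun e =>
      if e.1 ∈ u ∨ e.2 ∈ v then []
      else (transversals opts (e.1 :: u) (e.2 :: v)).map (e :: ·)

theorem mem_transversals {α β : Type*} [DecidableEq α] [DecidableEq β]
    {opts : List (List (α × β))} {l : List (α × β)} (h : List.Forall₂ (· ∈ ·) l opts)
    {u : List α} {v : List β} (hu : (l.map Prod.fst).Nodup) (hv : (l.map Prod.snd).Nodup)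
    (hlu : ∀ e ∈ l, e.1 ∉ u) (hlv : ∀ e ∈ l, e.2 ∉ v) : l ∈ transversals opts u v := by
  induction h generalizing u v with
  | nil => simp [transversals]
  | @cons e o l opts he _ ih =>
    simp only [List.map_cons, List.nodup_cons, List.mem_map, not_exists, not_and] at hu hv
    simp only [List.mem_cons, forall_eq_or_imp] at hlu hlv
    simp only [transversals, List.mem_flatMap]
    refine ⟨e, he, ?_⟩
    rw [if_neg (not_or.mpr ⟨hlu.1, hlv.1⟩)]
    refine List.mem_map_of_mem (ih hu.2 hv.2 (fun x hx => ?_) fun x hx => ?_)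
    · exact fun hm => (List.mem_cons.mp hm).elim (hu.1 x hx) (hlu.2 x hx)
    · exact fun hm => (List.mem_cons.mp hm).elim (hv.1 x hx) (hlv.2 x hx)

/-- The pairs `(j, k)` for which `(i, j, k)` satisfies `p`. -/
def rowPairs {n : ℕ} (p : (Fin 3 → Fin n) → Prop) [DecidablePred p] (i : Fin n) :
    List (Fin n × Fin n) :=
  (List.finRange n ×ˢ List.finRange n).filter fun e => p ![i, e.1, e.2]

theorem cell_three {n : ℕ} (σ : Fin (3 - 1) → Equiv.Perm (Fin n)) (i : Fin n) :
    cell σ i = ![i, σ 0 i, σ 1 i] := by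
  funext k
  fin_cases k <;> rfl

theorem per_ofPred_le_length_transversals {n : ℕ} (p : (Fin 3 → Fin n) → Prop)
    [DecidablePred p] :
    per (ofPred p) ≤ (transversals ((List.finRange n).map (rowPairs p)) [] []).length := by
  rw [per_ofPred, Nat.cast_le]
  refine (Finset.card_le_card_of_injOn
    (t := (transversals ((List.finRange n).map (rowPairs p)) [] []).toFinset)
    (fun σ => (List.finRange n).map fun i => (σ 0 i, σ 1 i)) ?_ ?_).trans
    (List.toFinset_card_le _)
  · intro σ hσ
    simp only [Finset.coe_filter, Finset.mem_univ, true_and, Set.mem_ofPred_eq] at hσ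
    simp only [List.coe_toFinset, Set.mem_ofPred_eq]
    refine mem_transversals ?_ ?_ ?_ (by simp) (by simp)
    · rw [List.forall₂_map_left_iff, List.forall₂_map_right_iff, List.forall₂_same]
      intro i _
      simpa [rowPairs, cell_three] using hσ i
    · rw [List.map_map]
      exact (List.nodup_finRange n).map (σ 0).injective
    · rw [List.map_map]
      exact (List.nodup_finRange n).map (σ 1).injective
  · intro σ _ τ _ h
    have h' : ∀ i, (σ 0 i, σ 1 i) = (τ 0 i, τ 1 i) := fun i =>
      List.map_inj_left.mp h i (List.mem_finRange i)
    funext k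
    ext i : 1
    fin_cases k
    · exact congrArg Prod.fst (h' i)
    · exact congrArg Prod.snd (h' i)

/-- The union of two disjoint diagonals of a `3`-dimensional matrix of order `3`. -/
def TwoDiagonals (α : Fin 3 → Fin 3) : Prop :=
  (α 0, α 1, α 2) ∈
    [((0 : Fin 3), (0 : Fin 3), (0 : Fin 3)), (1, 1, 2), (2, 2, 1),
      (0, 1, 1), (1, 2, 0), (2, 0, 2)]

instance : DecidablePred TwoDiagonals := fun _ => inferInstanceAs (Decidable (_ ∈ _))

end MDMatrix

open MDMatrix in
/-- there is a nonnegative `3`-dimensional matrix `A` of order `3` with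
`per (A ⊗ A) < (per A)^(2·3) = (per A)^6`. -/
theorem exists_kron_per_lt : ∃ A : MDMatrix 3 3, Nonneg A ∧
    per (kron A A) < per A ^ 6 := by
  refine ⟨ofPred TwoDiagonals, fun α => ?_, ?_⟩
  · unfold ofPred
    split_ifs <;> norm_num
  · have hper : per (ofPred TwoDiagonals) = 2 := by
      rw [per_ofPred]
      exact_mod_cast (by decide +kernel : (Finset.univ.filter
        fun σ : Fin (3 - 1) → Equiv.Perm (Fin 3) => ∀ i, TwoDiagonals (cell σ i)).card = 2)
    rw [kron_ofPred, hper]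
    refine (per_ofPred_le_length_transversals _).trans_lt
      ((Nat.cast_le.mpr (?_ : _ ≤ 40)).trans_lt (by norm_num))
    decide +kernel
end

section
/- There exist nonnegative 3-dimensional matrices A and B of order 2 such that per B = 0 but per(A ⊗ B) > 0. (Hence no upper bound of the form per(A ⊗ B) ≤ K (per A)^{n2}(per B)^{n1} can hold for multidimensional matrices.) -/
open scoped BigOperators

namespace MDMatrix

/-- A nonnegative matrix with a diagonal of positive entries has a positive permanent. -/
theorem per_pos_of_diagonal {d n : ℕ} {A : MDMatrix d n} (hA : Nonneg A)
    (σ : Fin (d - 1) → Equiv.Perm (Fin n))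
    (hσ : ∀ i : Fin n, 0 < A fun k => if h : (k : ℕ) = 0 then i
      else σ ⟨(k : ℕ) - 1, by have := k.isLt; omega⟩ i) :
    0 < per A :=
  Finset.sum_pos' (fun _ _ => Finset.prod_nonneg fun _ _ => hA _)
    ⟨σ, Finset.mem_univ _, Finset.prod_pos fun i _ => hσ i⟩

/-- The indicator of the indices of odd parity in the cube. -/
noncomputable def oddParity : MDMatrix 3 2 := fun α => if α 0 + α 1 + α 2 = 1 then 1 else 0

theorem oddParity_nonneg : Nonneg oddParity := fun α => by
  unfold oddParity
  split_ifs <;> norm_num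

theorem per_oddParity : per oddParity = 0 := by
  refine Finset.sum_eq_zero fun σ _ => ?_
  have key : ∀ p q : Equiv.Perm (Fin 2), ∃ i : Fin 2, ¬ (i + p i + q i = 1) := by decide
  obtain ⟨i, hi⟩ := key (σ 0) (σ 1)
  exact Finset.prod_eq_zero (Finset.mem_univ i) (if_neg hi)

theorem per_kron_one_oddParity_pos : 0 < per (kron (1 : MDMatrix 3 2) oddParity) := by
  refine per_pos_of_diagonal (fun γ => mul_nonneg zero_le_one (oddParity_nonneg _))
    ![(Equiv.swap 0 1 : Equiv.Perm (Fin 4)), Equiv.swap 1 2 * Equiv.swap 0 1] fun i => ?_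
  refine mul_pos zero_lt_one ?_
  unfold oddParity
  rw [if_pos]
  · exact zero_lt_one
  · revert i
    decide

end MDMatrix

open MDMatrix in
/-- there are nonnegative `3`-dimensional matrices `A`, `B` of order `2`
with `per B = 0` but `per (A ⊗ B) > 0`. -/
theorem exists_kron_per_pos : ∃ (A B : MDMatrix 3 2), Nonneg A ∧ Nonneg B ∧
    per B = 0 ∧ 0 < per (kron A B) := by
  exact ⟨1, oddParity, fun _ => zero_le_one, oddParity_nonneg, per_oddParity,
    per_kron_one_oddParity_pos⟩
end

section
/- For every d ≥ 3 and every n ≥ 2, with S = {1, 2}: (a) there exists a nonnegative d-dimensional (0,1)-matrix A of order n such that per A = 0 but per A_S > 0; and (b) there exists a nonnegative d-dimensional (0,1)-matrix A' of order n such that per A' > 0 but per A'_S = 0. (Hence the permanent of a contraction can be neither bounded below nor above in terms of the permanent of the original matrix.) -/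
open scoped BigOperators

namespace MDMatrix

/-- A nonnegative matrix has positive permanent as soon as one of the products in the defining
sum is positive. -/
theorem per_pos_of_diagonal_pos {d n : ℕ} {A : MDMatrix d n} (hA : Nonneg A)
    (σ : Fin (d - 1) → Equiv.Perm (Fin n))
    (hσ : ∀ i : Fin n, 0 < A fun k => if h : (k : ℕ) = 0 then i
      else σ ⟨(k : ℕ) - 1, by have := k.isLt; omega⟩ i) : 0 < per A :=
  Finset.sum_pos' (fun _ _ => Finset.prod_nonneg fun _ _ => hA _)
    ⟨σ, Finset.mem_univ _, Finset.prod_pos fun i _ => hσ i⟩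

/-- The permanent vanishes when all entries in some hyperplane of the first direction vanish. -/
theorem per_eq_zero_of_hyperplane_eq_zero {d n : ℕ} {A : MDMatrix (d + 1) n} (i : Fin n)
    (hA : ∀ α, α 0 = i → A α = 0) : per A = 0 :=
  Finset.sum_eq_zero fun _ _ =>
    Finset.prod_eq_zero (Finset.mem_univ i) (hA _ (by simp))

end MDMatrix

open MDMatrix in
/-- for every `d = m + 3 ≥ 3` and `n ≥ 2`, with `S = {1,2}` (here the first
two positions `{0,1}` of `Fin (m+3)`): (a) there is a `(0,1)`-matrix `A` with `per A = 0`
and `per A_S > 0`; (b) there is a `(0,1)`-matrix `A'` with `per A' > 0` and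
`per A'_S = 0`. -/
theorem per_contraction_unbounded {m n : ℕ} (hn : 2 ≤ n)
    (hc : (({0, 1} : Finset (Fin (m + 3)))ᶜ).card = m + 1) :
    (∃ A : MDMatrix (m + 3) n, (∀ α, A α = 0 ∨ A α = 1) ∧
        per A = 0 ∧ 0 < per (contract A {0, 1} hc)) ∧
    (∃ A' : MDMatrix (m + 3) n, (∀ α, A' α = 0 ∨ A' α = 1) ∧
        0 < per A' ∧ per (contract A' {0, 1} hc) = 0) := by
  have : NeZero n := ⟨by omega⟩
  refine ⟨⟨fun α => if α 0 = 0 ∧ α 1 = 0 then 1 else 0, fun α => ?_, ?_, ?_⟩,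
    ⟨fun α => if α 0 = α 1 then 0 else 1, fun α => ?_, ?_, ?_⟩⟩
  · by_cases h : α 0 = 0 ∧ α 1 = 0 <;> simp [h]
  · refine per_eq_zero_of_hyperplane_eq_zero ⟨1, by omega⟩ fun α h => if_neg fun h' => ?_
    simpa [Fin.ext_iff] using h.symm.trans h'.1
  · refine per_pos_of_diagonal_pos (fun β => ?_) (fun _ => 1) fun i => ?_ <;>
      simp [contract]
  · by_cases h : α 0 = α 1 <;> simp [h]
  · refine per_pos_of_diagonal_pos (fun α => ?_) (fun _ => Equiv.addRight 1) fun i => ?_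
    · split_ifs <;> norm_num
    · have h : (1 : Fin n) ≠ 0 := by
        simp [Fin.ext_iff, Nat.mod_eq_of_lt hn]
      simp [h]
  · exact per_eq_zero_of_hyperplane_eq_zero 0 fun β _ => by simp [contract]
end

section
/- Let A be a nonnegative d1-dimensional matrix of order n and B be a nonnegative d2-dimensional matrix of order n, with d1 + d2 ≥ 3. Then per(AB) ≥ per A · per B. -/
open scoped BigOperators

namespace MDMatrix

noncomputable section

/-- The symmetric form of the permanent: the sum over all `d`-tuples of permutations. -/
def fullPer {d n : ℕ} (A : MDMatrix d n) : ℝ :=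
  ∑ σ : Fin d → Equiv.Perm (Fin n), ∏ i : Fin n, A fun k => σ k i

/-- The sum over tuples of permutations whose `p`-th component is fixed to be `τ`. -/
def fixedPer {e n : ℕ} (A : MDMatrix (e + 1) n) (p : Fin (e + 1))
    (τ : Equiv.Perm (Fin n)) : ℝ :=
  ∑ σ : Fin e → Equiv.Perm (Fin n), ∏ i : Fin n, A (p.insertNth (τ i) fun k => σ k i)

theorem fixedPer_eq_fixedPer_one {e n : ℕ} (A : MDMatrix (e + 1) n) (p : Fin (e + 1))
    (τ : Equiv.Perm (Fin n)) : fixedPer A p τ = fixedPer A p 1 := by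
  unfold fixedPer
  rw [← Equiv.sum_comp (Equiv.mulRight (fun _ : Fin e => τ))]
  refine Finset.sum_congr rfl fun σ _ => ?_
  rw [← Equiv.prod_comp τ (fun i => A (p.insertNth ((1 : Equiv.Perm (Fin n)) i) fun k => σ k i))]
  rfl

theorem fullPer_eq_sum_fixedPer {e n : ℕ} (A : MDMatrix (e + 1) n) (p : Fin (e + 1)) :
    fullPer A = ∑ τ, fixedPer A p τ := by
  unfold fullPer fixedPer
  rw [← Equiv.sum_comp (Fin.insertNthEquiv (fun _ => Equiv.Perm (Fin n)) p),
    Fintype.sum_prod_type]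
  refine Finset.sum_congr rfl fun τ _ => Finset.sum_congr rfl fun σ _ =>
    Finset.prod_congr rfl fun i _ => congrArg A ?_
  funext k
  refine Fin.succAboveCases p ?_ (fun j => ?_) k <;> simp

theorem fullPer_eq_factorial_mul_fixedPer {e n : ℕ} (A : MDMatrix (e + 1) n) (p : Fin (e + 1))
    (τ : Equiv.Perm (Fin n)) : fullPer A = (n.factorial : ℝ) * fixedPer A p τ := by
  rw [fullPer_eq_sum_fixedPer A p, fixedPer_eq_fixedPer_one A p τ]
  simp [fixedPer_eq_fixedPer_one A p, Fintype.card_perm]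

theorem per_eq_fixedPer {e n : ℕ} (A : MDMatrix (e + 1) n) : per A = fixedPer A 0 1 := by
  unfold per fixedPer
  refine Finset.sum_congr rfl fun σ _ => Finset.prod_congr rfl fun i _ => congrArg A ?_
  funext k
  refine Fin.cases ?_ (fun j => ?_) k <;> simp

theorem fullPer_eq_factorial_mul_per {d n : ℕ} (hd : 1 ≤ d) (A : MDMatrix d n) :
    fullPer A = (n.factorial : ℝ) * per A := by
  obtain _ | e := d
  · omega
  · rw [per_eq_fixedPer, fullPer_eq_factorial_mul_fixedPer A 0 1]

theorem fixedPer_eq_per {e n : ℕ} (A : MDMatrix (e + 1) n) (p : Fin (e + 1))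
    (τ : Equiv.Perm (Fin n)) : fixedPer A p τ = per A := by
  have hn : (n.factorial : ℝ) ≠ 0 := by exact_mod_cast n.factorial_ne_zero
  apply mul_left_cancel₀ hn
  rw [← fullPer_eq_factorial_mul_fixedPer, fullPer_eq_factorial_mul_per (Nat.le_add_left 1 e)]

/-- A product of sums dominates the part of its expansion indexed by permutations. -/
theorem sum_perm_prod_le_prod_sum {n : ℕ} (f : Fin n → Fin n → ℝ) (hf : ∀ i j, 0 ≤ f i j) :
    ∑ τ : Equiv.Perm (Fin n), ∏ i, f i (τ i) ≤ ∏ i, ∑ j, f i j := by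
  rw [Fintype.prod_sum, ← Finset.sum_image (s := Finset.univ)
    (g := fun τ : Equiv.Perm (Fin n) => (τ : Fin n → Fin n)) (f := fun g => ∏ i, f i (g i))
    (fun _ _ _ _ h => DFunLike.coe_injective h)]
  exact Finset.sum_le_sum_of_subset_of_nonneg (Finset.subset_univ _)
    fun g _ _ => Finset.prod_nonneg fun i _ => hf i _

theorem sum_fixedPer_mul_fixedPer_le_fullPer_dot {e1 e2 n : ℕ}
    (A : MDMatrix (e1 + 1) n) (B : MDMatrix (e2 + 1) n) (hA : Nonneg A) (hB : Nonneg B) :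
    ∑ τ, fixedPer A (Fin.last e1) τ * fixedPer B 0 τ ≤ fullPer (dot A B) := by
  calc
    _ = ∑ τ : Equiv.Perm (Fin n), ∑ σ : Fin (e1 + e2) → Equiv.Perm (Fin n), ∏ i : Fin n,
          (A (Fin.snoc (fun j => σ (Fin.castAdd e2 j) i) (τ i)) *
            B (Fin.cons (τ i) fun j => σ (Fin.natAdd e1 j) i)) := by
      refine Finset.sum_congr rfl fun τ _ => ?_
      unfold fixedPer
      rw [← Equiv.sum_comp (Fin.appendEquiv e1 e2), Fintype.sum_prod_type,
        Finset.sum_mul_sum]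
      simp [Finset.prod_mul_distrib, Fin.insertNth_last', Fin.insertNth_zero']
    _ ≤ fullPer (dot A B) := by
      rw [Finset.sum_comm]
      exact Finset.sum_le_sum fun σ _ =>
        sum_perm_prod_le_prod_sum (fun i t => A (Fin.snoc (fun j => σ (Fin.castAdd e2 j) i) t) *
          B (Fin.cons t fun j => σ (Fin.natAdd e1 j) i)) fun i t => mul_nonneg (hA _) (hB _)

end

end MDMatrix

open MDMatrix in
/-- for nonnegative matrices `A` (dimension `d1 = e1 + 1`) and `B`
(dimension `d2 = e2 + 1`) of order `n` with `d1 + d2 ≥ 3`, `per (AB) ≥ per A * per B`. -/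
theorem per_dot_product_ge {e1 e2 n : ℕ}
    (A : MDMatrix (e1 + 1) n) (B : MDMatrix (e2 + 1) n)
    (hA : Nonneg A) (hB : Nonneg B) (hd : 1 ≤ e1 + e2) :
    per (dot A B) ≥ per A * per B := by
  have hn : (0 : ℝ) < n.factorial := by exact_mod_cast n.factorial_pos
  refine le_of_mul_le_mul_left ?_ hn
  rw [← fullPer_eq_factorial_mul_per hd]
  simpa [fixedPer_eq_per, Fintype.card_perm] using
    sum_fixedPer_mul_fixedPer_le_fullPer_dot A B hA hB
end
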